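/- Let p be a norm on ℝⁿ and μ ≥ 1 a constant such that the function x ↦ p(x)²/2 is differentiable with Lipschitz continuous gradient with constant μ with respect to p, in the sense that p(y)²/2 ≤ p(x)²/2 + D(p²/2)(x)(y − x) + (μ/2)·p(y − x)² for all x, y ∈ ℝⁿ. Then the conjugate function d(y) := p*(y)²/2, where p* is the dual norm of p, is strongly convex with respect to p* with parameter 1/μ: d(y + h) ≥ d(y) + ⟨g, h⟩ + (1/(2μ))·p*(h)² for all y, h ∈ ℝⁿ and any subgradient g of d at y. -/

import Mathlib

open scoped InnerProductSpace

/-- The dual norm of a norm `N` on `ℝⁿ`: `N* y = sup {⟨y, x⟩ : N x ≤ 1}`. -/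
noncomputable def dualNorm {n : ℕ} (N : EuclideanSpace ℝ (Fin n) → ℝ)
    (y : EuclideanSpace ℝ (Fin n)) : ℝ :=
  sSup ((fun x => ⟪y, x⟫_ℝ) '' {x | N x ≤ 1})

section DualNorm

variable {n : ℕ} {p : EuclideanSpace ℝ (Fin n) → ℝ}

theorem apply_zero_of_abs_homogeneous (hphom : ∀ (c : ℝ) (x), p (c • x) = |c| * p x) :
    p 0 = 0 := by
  simpa using hphom 0 0

theorem nonneg_of_abs_homogeneous (hphom : ∀ (c : ℝ) (x), p (c • x) = |c| * p x)
    (hptri : ∀ x y, p (x + y) ≤ p x + p y) (x : EuclideanSpace ℝ (Fin n)) : 0 ≤ p x := by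
  have h1 := hptri x ((-1 : ℝ) • x)
  have h2 := hphom (-1) x
  rw [h2] at h1
  simp [apply_zero_of_abs_homogeneous hphom] at h1
  linarith

/-- A continuous norm on `ℝⁿ` dominates a positive multiple of the Euclidean norm. -/
theorem exists_pos_mul_norm_le (hphom : ∀ (c : ℝ) (x), p (c • x) = |c| * p x)
    (hptri : ∀ x y, p (x + y) ≤ p x + p y) (hpdef : ∀ x, p x = 0 → x = 0)
    (hcont : Continuous p) : ∃ c > 0, ∀ x, c * ‖x‖ ≤ p x := by
  have hnonneg := nonneg_of_abs_homogeneous hphom hptri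
  rcases (Metric.sphere (0 : EuclideanSpace ℝ (Fin n)) 1).eq_empty_or_nonempty with hS | hS
  · refine ⟨1, one_pos, fun x => ?_⟩
    by_cases hx : x = 0
    · simpa [hx] using hnonneg 0
    · have : ‖x‖⁻¹ • x ∈ Metric.sphere (0 : EuclideanSpace ℝ (Fin n)) 1 := by
        simp [norm_smul, hx]
      simp [hS] at this
  · obtain ⟨u, hu, hmin⟩ := (isCompact_sphere _ _).exists_isMinOn hS hcont.continuousOn
    have hu0 : u ≠ 0 := by
      rintro rfl
      simp at hu
    refine ⟨p u, lt_of_le_of_ne (hnonneg u) fun h => hu0 (hpdef u h.symm), fun x => ?_⟩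
    by_cases hx : x = 0
    · simpa [hx] using hnonneg 0
    · have hmem : ‖x‖⁻¹ • x ∈ Metric.sphere (0 : EuclideanSpace ℝ (Fin n)) 1 := by
        simp [norm_smul, hx]
      have h : p u ≤ p (‖x‖⁻¹ • x) := hmin hmem
      rw [hphom, abs_of_nonneg (by positivity)] at h
      have hpos : 0 < ‖x‖ := norm_pos_iff.2 hx
      calc p u * ‖x‖ ≤ (‖x‖⁻¹ * p x) * ‖x‖ := by gcongr
        _ = p x := by field_simp

theorem bddAbove_inner_image_of_mul_norm_le {c : ℝ} (hc : 0 < c) (h : ∀ x, c * ‖x‖ ≤ p x)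
    (y : EuclideanSpace ℝ (Fin n)) :
    BddAbove ((fun x => ⟪y, x⟫_ℝ) '' {x | p x ≤ 1}) := by
  refine ⟨‖y‖ * c⁻¹, ?_⟩
  rintro _ ⟨x, hx, rfl⟩
  have hx' : ‖x‖ ≤ c⁻¹ := by
    rw [← one_div, le_div_iff₀ hc, mul_comm]
    exact (h x).trans hx
  exact (real_inner_le_norm y x).trans (by gcongr)

theorem mul_dualNorm_le (hp0 : p 0 = 0) {t C : ℝ} (ht : 0 ≤ t)
    {y : EuclideanSpace ℝ (Fin n)} (h : ∀ x, p x ≤ 1 → t * ⟪y, x⟫_ℝ ≤ C) :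
    t * dualNorm p y ≤ C := by
  have h0 : p 0 ≤ 1 := by simp [hp0]
  rcases ht.eq_or_lt with rfl | ht
  · simpa using h 0 h0
  · rw [mul_comm, ← le_div_iff₀ ht]
    refine csSup_le (Set.Nonempty.image _ ⟨0, h0⟩) ?_
    rintro _ ⟨x, hx, rfl⟩
    rw [le_div_iff₀ ht, mul_comm]
    exact h x hx

theorem dualNorm_nonneg (hp0 : p 0 = 0)
    (hbdd : ∀ y, BddAbove ((fun x => ⟪y, x⟫_ℝ) '' {x | p x ≤ 1}))
    (y : EuclideanSpace ℝ (Fin n)) : 0 ≤ dualNorm p y :=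
  le_csSup (hbdd y) ⟨0, by simp [hp0], by simp⟩

theorem inner_le_dualNorm_mul (hphom : ∀ (c : ℝ) (x), p (c • x) = |c| * p x)
    (hptri : ∀ x y, p (x + y) ≤ p x + p y) (hpdef : ∀ x, p x = 0 → x = 0)
    (hbdd : ∀ y, BddAbove ((fun x => ⟪y, x⟫_ℝ) '' {x | p x ≤ 1}))
    (y x : EuclideanSpace ℝ (Fin n)) : ⟪y, x⟫_ℝ ≤ dualNorm p y * p x := by
  rcases (nonneg_of_abs_homogeneous hphom hptri x).eq_or_lt with hx | hx
  · simp [hpdef x hx.symm, apply_zero_of_abs_homogeneous hphom]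
  · have h : ⟪y, (p x)⁻¹ • x⟫_ℝ ≤ dualNorm p y := by
      refine le_csSup (hbdd y) ⟨_, ?_, rfl⟩
      rw [Set.mem_ofPred_eq, hphom, abs_of_pos (inv_pos.2 hx), inv_mul_cancel₀ hx.ne']
    rw [real_inner_smul_right, inv_mul_eq_div, div_le_iff₀ hx] at h
    exact h

theorem inner_le_half_sq_dualNorm_add_half_sq
    (hphom : ∀ (c : ℝ) (x), p (c • x) = |c| * p x)
    (hptri : ∀ x y, p (x + y) ≤ p x + p y) (hpdef : ∀ x, p x = 0 → x = 0)
    (hbdd : ∀ y, BddAbove ((fun x => ⟪y, x⟫_ℝ) '' {x | p x ≤ 1}))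
    (y x : EuclideanSpace ℝ (Fin n)) :
    ⟪y, x⟫_ℝ ≤ dualNorm p y ^ 2 / 2 + p x ^ 2 / 2 := by
  have := inner_le_dualNorm_mul hphom hptri hpdef hbdd y x
  nlinarith [sq_nonneg (dualNorm p y - p x)]

/-- The gradient inequality for half the square of a norm. -/
theorem fderiv_half_sq_le (hphom : ∀ (c : ℝ) (x), p (c • x) = |c| * p x)
    (hptri : ∀ x y, p (x + y) ≤ p x + p y)
    {x : EuclideanSpace ℝ (Fin n)} (hdiff : DifferentiableAt ℝ (fun z => p z ^ 2 / 2) x)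
    (y : EuclideanSpace ℝ (Fin n)) :
    fderiv ℝ (fun z => p z ^ 2 / 2) x (y - x) ≤ p y ^ 2 / 2 - p x ^ 2 / 2 := by
  have hconv : ConvexOn ℝ Set.univ p := by
    refine ⟨convex_univ, fun a _ b _ s t hs ht _ => (hptri _ _).trans ?_⟩
    simp [hphom, abs_of_nonneg hs, abs_of_nonneg ht]
  have hsq : ConvexOn ℝ Set.univ (fun z => p z ^ 2 / 2) := by
    have := (hconv.pow (fun z _ => nonneg_of_abs_homogeneous hphom hptri z) 2).smul
      (by norm_num : (0 : ℝ) ≤ 1 / 2)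
    refine this.congr fun z _ => ?_
    simp
    ring
  have hline : ConvexOn ℝ Set.univ
      ((fun z => p z ^ 2 / 2) ∘ (AffineMap.lineMap x y : ℝ →ᵃ[ℝ] _)) := by
    simpa using hsq.comp_affineMap (AffineMap.lineMap x y : ℝ →ᵃ[ℝ] _)
  have hderiv : HasDerivAt ((fun z => p z ^ 2 / 2) ∘ (AffineMap.lineMap x y : ℝ →ᵃ[ℝ] _))
      (fderiv ℝ (fun z => p z ^ 2 / 2) x (y - x)) 0 := by
    refine HasFDerivAt.comp_hasDerivAt (0 : ℝ) ?_ AffineMap.hasDerivAt_lineMap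
    simpa using hdiff.hasFDerivAt
  have := hline.le_slope_of_hasDerivAt (Set.mem_univ 0) (Set.mem_univ 1) zero_lt_one hderiv
  simpa [slope_def_field] using this

/-- Equality in the Fenchel inequality is attained at any subgradient `z` of `p²/2`. -/
theorem half_sq_dualNorm_le_of_subgradient (hphom : ∀ (c : ℝ) (x), p (c • x) = |c| * p x)
    (hptri : ∀ x y, p (x + y) ≤ p x + p y)
    (hbdd : ∀ y, BddAbove ((fun x => ⟪y, x⟫_ℝ) '' {x | p x ≤ 1}))
    {z g : EuclideanSpace ℝ (Fin n)}
    (hz : ∀ x, ⟪z, x - g⟫_ℝ ≤ p x ^ 2 / 2 - p g ^ 2 / 2) :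
    dualNorm p z ^ 2 / 2 ≤ ⟪z, g⟫_ℝ - p g ^ 2 / 2 := by
  have hp0 := apply_zero_of_abs_homogeneous hphom
  set t := dualNorm p z with ht
  have ht0 : 0 ≤ t := dualNorm_nonneg hp0 hbdd z
  have h : t * dualNorm p z ≤ ⟪z, g⟫_ℝ - p g ^ 2 / 2 + t ^ 2 / 2 := by
    refine mul_dualNorm_le hp0 ht0 fun x hx => ?_
    have h1 := hz (t • x)
    rw [inner_sub_right, real_inner_smul_right, hphom, abs_of_nonneg ht0] at h1
    have h2 : (t * p x) ^ 2 ≤ t ^ 2 := by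
      have := nonneg_of_abs_homogeneous hphom hptri x
      exact pow_le_pow_left₀ (by positivity) (mul_le_of_le_one_right ht0 hx) 2
    linarith
  rw [← ht] at h
  linarith

end DualNorm

/-- Duality of smoothness and strong convexity: if `p²/2` has `μ`-Lipschitz gradient
with respect to the norm `p` (quadratic upper bound), then `d = (p*)²/2` is strongly
convex with respect to `p*` with parameter `1/μ`: for any subgradient `g` of `d` at `y`,
`d (y + h) ≥ d y + ⟨g, h⟩ + (1/(2μ)) p*(h)²`. -/
theorem strong_convexity_of_dual_of_smooth {n : ℕ}
    (p : EuclideanSpace ℝ (Fin n) → ℝ)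
    (hphom : ∀ (c : ℝ) (x), p (c • x) = |c| * p x)
    (hptri : ∀ x y, p (x + y) ≤ p x + p y)
    (hpdef : ∀ x, p x = 0 → x = 0)
    (μ : ℝ) (hμ : 1 ≤ μ)
    (hdiff : Differentiable ℝ (fun x => p x ^ 2 / 2))
    (hsmooth : ∀ x y, p y ^ 2 / 2 ≤ p x ^ 2 / 2
        + fderiv ℝ (fun z => p z ^ 2 / 2) x (y - x) + μ / 2 * p (y - x) ^ 2) :
    ∀ (y h g : EuclideanSpace ℝ (Fin n)),
      (∀ z, dualNorm p y ^ 2 / 2 + ⟪g, z - y⟫_ℝ ≤ dualNorm p z ^ 2 / 2) →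
      dualNorm p y ^ 2 / 2 + ⟪g, h⟫_ℝ + 1 / (2 * μ) * dualNorm p h ^ 2 ≤
        dualNorm p (y + h) ^ 2 / 2 := by
  intro y h g hg
  have hp0 := apply_zero_of_abs_homogeneous hphom
  have hnonneg := nonneg_of_abs_homogeneous hphom hptri
  have hcont : Continuous p := by
    have hsqrt : p = fun x => √(2 * (p x ^ 2 / 2)) := by
      ext x
      rw [mul_div_cancel₀ _ two_ne_zero, Real.sqrt_sq (hnonneg x)]
    rw [hsqrt]
    exact (hdiff.continuous.const_mul 2).sqrt
  obtain ⟨c, hc, hle⟩ := exists_pos_mul_norm_le hphom hptri hpdef hcont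
  have hbdd := bddAbove_inner_image_of_mul_norm_le hc hle
  have hfenchel := inner_le_half_sq_dualNorm_add_half_sq hphom hptri hpdef hbdd
  have hconj : dualNorm p y ^ 2 / 2 + p g ^ 2 / 2 ≤ ⟪y, g⟫_ℝ := by
    set z := (InnerProductSpace.toDual ℝ _).symm (fderiv ℝ (fun z => p z ^ 2 / 2) g) with hz
    have h1 : dualNorm p z ^ 2 / 2 ≤ ⟪z, g⟫_ℝ - p g ^ 2 / 2 := by
      refine half_sq_dualNorm_le_of_subgradient hphom hptri hbdd fun x => ?_
      rw [hz, InnerProductSpace.toDual_symm_apply]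
      exact fderiv_half_sq_le hphom hptri (hdiff g) x
    have h2 := hg z
    rw [inner_sub_right, real_inner_comm z g, real_inner_comm y g] at h2
    linarith
  have hgrad : fderiv ℝ (fun z => p z ^ 2 / 2) g = innerSL ℝ y := by
    have hmin : IsLocalMin (fun x => p x ^ 2 / 2 - innerSL ℝ y x) g := by
      refine Filter.Eventually.of_forall fun x => ?_
      have := hfenchel y x
      simp only [innerSL_apply_apply]
      linarith
    have h0 := hmin.hasFDerivAt_eq_zero
      ((hdiff g).hasFDerivAt.sub (innerSL ℝ y).hasFDerivAt)
    exact sub_eq_zero.1 h0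
  set t := dualNorm p h / μ with ht
  have hμ0 : 0 < μ := by linarith
  have ht0 : 0 ≤ t := div_nonneg (dualNorm_nonneg hp0 hbdd h) hμ0.le
  have hsup : t * dualNorm p h ≤ dualNorm p (y + h) ^ 2 / 2 - dualNorm p y ^ 2 / 2
      - ⟪g, h⟫_ℝ + μ / 2 * t ^ 2 := by
    refine mul_dualNorm_le hp0 ht0 fun x hx => ?_
    have h1 := hsmooth g (g + t • x)
    have h2 := hfenchel (y + h) (g + t • x)
    rw [add_sub_cancel_left, hgrad, innerSL_apply_apply, real_inner_smul_right, hphom,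
      abs_of_nonneg ht0] at h1
    simp only [inner_add_left, inner_add_right, real_inner_smul_right] at h2
    have h3 : μ / 2 * (t * p x) ^ 2 ≤ μ / 2 * t ^ 2 := by
      have := hnonneg x
      have := mul_le_of_le_one_right ht0 hx
      gcongr
    rw [real_inner_comm h g]
    linarith
  have heq : t * dualNorm p h - μ / 2 * t ^ 2 = 1 / (2 * μ) * dualNorm p h ^ 2 := by
    rw [ht]
    field_simp
    ring
  linarith
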